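/- arXiv:2001.09904 — 2 statements merged into one kernel-verified Lean document; each statement's English description precedes it below -/
import Mathlib

section
/- The free group of rank 3 is not ∀-homogeneous: there exist elements g and h of the free group F₃ of rank 3 such that g and h have the same ∀-type in F₃ (every universal formula in one free variable satisfied by g in F₃ is satisfied by h, and conversely), g is primitive in F₃ (belongs to some free basis of F₃) while h is not primitive, and consequently no automorphism of F₃ sends h to g. -/
open FirstOrder

/-- Function symbols of the first-order language of groups: a constant for the identity,
a unary symbol for inversion, and a binary symbol for multiplication. -/
inductive GroupFn : ℕ → Type
  | one : GroupFn 0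
  | inv : GroupFn 1
  | mul : GroupFn 2

/-- The first-order language of groups. -/
def Lgp : Language := ⟨GroupFn, fun _ => Empty⟩

/-- Every group is an `Lgp`-structure in the natural way. -/
instance (priority := 100) groupLgpStructure (G : Type*) [Group G] : Lgp.Structure G where
  funMap {_} f x :=
    match f with
    | .one => 1
    | .inv => (x 0)⁻¹
    | .mul => x 0 * x 1
  RelMap {_} r := Empty.elim r

/-- A formula is universal if it is (syntactically) a block of universal quantifiers applied
to a quantifier-free formula. -/
def IsUniversalF {α : Type*} (φ : Lgp.Formula α) : Prop :=
  ∃ (n : ℕ) (ψ : Lgp.BoundedFormula α n), ψ.IsQF ∧ φ = ψ.alls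

/-- An element of a group is primitive if it belongs to some free basis of the group. -/
def IsPrimitiveElement {G : Type*} [Group G] (g : G) : Prop :=
  ∃ (ι : Type) (B : FreeGroupBasis ι G) (i : ι), B i = g


section Transfer

open FirstOrder Filter

lemma term_realize_hom {G : Type} [Group G] (f : G →* G) {β : Type} (t : Lgp.Term β) (v : β → G) :
    t.realize (fun i => f (v i)) = f (t.realize v) := by
  induction t with
  | var i => rfl
  | func F ts ih =>
    cases F with
    | one =>
      change (1 : G) = f 1
      simp
    | inv =>
      change ((ts 0).realize (fun i => f (v i)))⁻¹ = f (((ts 0).realize v)⁻¹)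
      rw [ih 0, map_inv]
    | mul =>
      change (ts 0).realize (fun i => f (v i)) * (ts 1).realize (fun i => f (v i)) =
        f ((ts 0).realize v * (ts 1).realize v)
      rw [ih 0, ih 1, map_mul]

lemma qf_transfer {G : Type} [Group G] (f : ℕ → G →* G)
    (hf : ∀ w : G, w ≠ 1 → ∀ᶠ n in atTop, f n w ≠ 1) {n : ℕ}
    (ψ : Lgp.BoundedFormula (Fin 1) n) (hψ : ψ.IsQF) (v : Fin 1 → G) (xs : Fin n → G) :
    ∀ᶠ k in atTop, (ψ.Realize (fun i => f k (v i)) (fun i => f k (xs i)) ↔ ψ.Realize v xs) := by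
  induction hψ with
  | falsum => exact Eventually.of_forall fun k => Iff.rfl
  | of_isAtomic h =>
    cases h with
    | equal t₁ t₂ =>
      have key : ∀ k, (Sum.elim (fun i => f k (v i)) (fun i => f k (xs i))) =
          fun i => f k (Sum.elim v xs i) := by
        intro k; funext i; cases i <;> rfl
      by_cases h : t₁.realize (Sum.elim v xs) = t₂.realize (Sum.elim v xs)
      · refine Eventually.of_forall fun k => ?_
        simp only [Language.BoundedFormula.realize_bdEqual, key, term_realize_hom, h]
      · have := hf ((t₁.realize (Sum.elim v xs)) * (t₂.realize (Sum.elim v xs))⁻¹)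
          (by rwa [Ne, mul_inv_eq_one])
        filter_upwards [this] with k hk
        simp only [Language.BoundedFormula.realize_bdEqual, key, term_realize_hom]
        rw [map_mul, map_inv, Ne, mul_inv_eq_one] at hk
        exact iff_of_false hk h
    | rel R ts => exact Empty.elim R
  | imp h₁ h₂ ih₁ ih₂ =>
    filter_upwards [ih₁ , ih₂] with k h1 h2
    simp only [Language.BoundedFormula.realize_imp, h1, h2]

lemma universal_transfer {G : Type} [Group G] (f : ℕ → G →* G)
    (hf : ∀ w : G, w ≠ 1 → ∀ᶠ n in atTop, f n w ≠ 1) (a b : G) (hab : ∀ n, f n a = b)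
    (φ : Lgp.Formula (Fin 1)) (hφ : IsUniversalF φ) (h : φ.Realize (fun _ => b)) :
    φ.Realize (fun _ => a) := by
  obtain ⟨n, ψ, hψ, rfl⟩ := hφ
  rw [Language.BoundedFormula.realize_alls] at h ⊢
  intro xs
  obtain ⟨k, hk⟩ := (qf_transfer f hf ψ hψ (fun _ => a) xs).exists
  rw [← hk]
  simp only [hab]
  exact h _

end Transfer

section Prelim

/-- The generators. -/
abbrev F3 := FreeGroup (Fin 3)
abbrev F2 := FreeGroup (Fin 2)

def gX : F3 := FreeGroup.of 0
def gY : F3 := FreeGroup.of 1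
def gZ : F3 := FreeGroup.of 2
def px : F2 := FreeGroup.of 0
def py : F2 := FreeGroup.of 1

def cc : F2 := px * py * px⁻¹ * px⁻¹ * py⁻¹
def uu : F2 := py * px * py⁻¹

def hh : F3 := gX * gY * gX⁻¹ * gX⁻¹ * gY⁻¹ * gZ * gZ

def inc : F2 →* F3 := FreeGroup.map ![0, 1]

lemma inc_inj : Function.Injective inc :=
  FreeGroup.map_injective (by decide)

@[simp] lemma inc_px : inc px = gX := by simp [inc, px, gX]
@[simp] lemma inc_py : inc py = gY := by simp [inc, py, gY]

def kap : F3 →* F3 := FreeGroup.lift ![gX, gY * gX * gY⁻¹, gZ]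
@[simp] lemma kap_X : kap gX = gX := by simp [kap, gX]
@[simp] lemma kap_Y : kap gY = gY * gX * gY⁻¹ := by simp [kap, gY]
@[simp] lemma kap_Z : kap gZ = gZ := by simp [kap, gZ]

def shiftAct : Multiplicative ℤ →* MulAut (FreeGroup (Fin 3 × ℤ)) where
  toFun k := FreeGroup.freeGroupCongr ((Equiv.refl _).prodCongr (Equiv.addRight k.toAdd))
  map_one' := by
    ext w
    induction w using FreeGroup.induction_on <;> simp_all
  map_mul' a b := by
    ext w
    induction w using FreeGroup.induction_on with
    | C1 => simp
    | of i => simp [Prod.map, add_comm (Multiplicative.toAdd a), add_assoc]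
    | inv_of i ih => rw [map_inv, ih, map_inv]
    | mul x y hx hy => rw [map_mul, hx, hy, map_mul]

lemma shiftAct_one : shiftAct (Multiplicative.ofAdd 1) (FreeGroup.of ((0 : Fin 3), (0 : ℤ))) =
    FreeGroup.of ((0 : Fin 3), (1 : ℤ)) := by
  simp [shiftAct]

lemma kap_inj : Function.Injective kap := by
  let H := FreeGroup (Fin 3 × ℤ) ⋊[shiftAct] Multiplicative ℤ
  let ψ : F3 →* H := FreeGroup.lift ![SemidirectProduct.inl (FreeGroup.of (0, 0)),
    SemidirectProduct.inr (Multiplicative.ofAdd 1), SemidirectProduct.inl (FreeGroup.of (2, 0))]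
  let m : Fin 3 → Fin 3 × ℤ := ![(0, 0), (0, 1), (2, 0)]
  have hm : Function.Injective m := by
    intro i j; fin_cases i <;> fin_cases j <;> simp [m]
  have h : ψ.comp kap = (SemidirectProduct.inl).comp (FreeGroup.map m) := by
    refine FreeGroup.ext_hom _ _ fun i => ?_
    fin_cases i
    · simp [ψ, kap, m, gX]
    · have := SemidirectProduct.inl_aut (φ := shiftAct) (Multiplicative.ofAdd 1)
          (FreeGroup.of ((0 : Fin 3), (0:ℤ)))
      rw [shiftAct_one, map_inv] at this
      simp [ψ, kap, m, gX, gY]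
      exact this.symm
    · simp [ψ, kap, m, gZ]
  have h2 : Function.Injective (ψ.comp kap) := by
    rw [h]
    exact (SemidirectProduct.inl_injective).comp (FreeGroup.map_injective hm)
  exact Function.Injective.of_comp (f := ψ) h2

/-- X ↦ h, with free image of rank three. -/
def phi : F3 →* F3 := FreeGroup.lift ![hh, gY * gX * gY⁻¹, gZ]

lemma phi_X : phi gX = hh := by simp [phi, gX]

lemma phi_inj : Function.Injective phi := by
  let μ : F3 →* F3 := FreeGroup.lift ![gX * gY⁻¹ * gY⁻¹ * gZ * gZ, gY, gZ]
  let μ' : F3 →* F3 := FreeGroup.lift ![gX * gZ⁻¹ * gZ⁻¹ * gY * gY, gY, gZ]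
  have h1 : μ'.comp μ = MonoidHom.id _ := by
    ext i
    fin_cases i <;> simp [μ, μ', gX, gY, gZ, mul_assoc]
  have h2 : phi = kap.comp μ := by
    ext i
    fin_cases i <;> simp [phi, hh, kap, μ, gX, gY, gZ, mul_assoc]
  have h3 : Function.Injective μ := by
    apply Function.LeftInverse.injective (g := μ')
    intro w
    exact DFunLike.congr_fun h1 w
  rw [h2]
  exact kap_inj.comp h3

def tau : F2 →* F2 := FreeGroup.lift ![cc, uu]

lemma tau_inj : Function.Injective tau := by
  let μ : F2 →* F2 := FreeGroup.lift ![px * py⁻¹ * py⁻¹, py]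
  let μ' : F2 →* F2 := FreeGroup.lift ![px * py * py, py]
  have h1 : μ'.comp μ = MonoidHom.id _ := by
    ext i
    fin_cases i <;> simp [μ, μ', px, py, mul_assoc]
  have h2 : inc.comp tau = kap.comp (inc.comp μ) := by
    ext i
    fin_cases i <;> simp [inc, tau, cc, uu, px, py, kap, μ, gX, gY, gZ, mul_assoc]
  have h3 : Function.Injective μ := by
    apply Function.LeftInverse.injective (g := μ')
    intro w
    exact DFunLike.congr_fun h1 w
  have h4 : Function.Injective (inc.comp tau) := by
    rw [h2]
    exact kap_inj.comp (inc_inj.comp h3)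
  exact Function.Injective.of_comp (f := inc) h4

/-- Exponent sum in x. -/
def chi : F2 →* Multiplicative ℤ := FreeGroup.lift ![Multiplicative.ofAdd 1, 1]

lemma chi_cc : chi cc = Multiplicative.ofAdd (-1) := by
  simp [chi, cc, px, py]

lemma cc_zpow_eq_one {k : ℤ} (h : cc ^ k = 1) : k = 0 := by
  have h2 := congrArg chi h
  rw [map_zpow, chi_cc, map_one, ← ofAdd_zsmul] at h2
  have := congrArg Multiplicative.toAdd h2
  simpa using this

lemma cent (a : F2) (h : Commute a cc) : ∃ k : ℤ, a = cc ^ k := by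
  let S : Subgroup F2 := Subgroup.closure {a, cc}
  have hcomm : ∀ s ∈ S, ∀ t ∈ S, s * t = t * s := by
    have : IsMulCommutative S := Subgroup.isMulCommutative_closure (by
      rintro s (rfl | rfl) t (rfl | rfl)
      · rfl
      · exact h
      · exact h.symm
      · rfl)
    intro s hs t ht
    exact congrArg Subtype.val (this.is_comm.comm ⟨s, hs⟩ ⟨t, ht⟩)
  let e := IsFreeGroup.toFreeGroup S
  have hsub : Subsingleton (IsFreeGroup.Generators S) := by
    constructor
    intro i j
    by_contra hij
    have : Nontrivial (IsFreeGroup.Generators S) := ⟨i, j, hij⟩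
    have h1 : FreeGroup.of i * FreeGroup.of j = FreeGroup.of j * FreeGroup.of i := by
      obtain ⟨s, hs⟩ := e.surjective (FreeGroup.of i)
      obtain ⟨t, ht⟩ := e.surjective (FreeGroup.of j)
      rw [← hs, ← ht, ← map_mul, ← map_mul]
      congr 1
      exact Subtype.ext (hcomm s s.2 t t.2)
    classical
    have h2 := congrArg (FreeGroup.lift (fun k => if k = i then Equiv.swap (0 : Fin 3) 1
      else Equiv.swap (1 : Fin 3) 2)) h1
    have hji : ¬ j = i := fun h => hij h.symm
    simp only [map_mul, FreeGroup.lift_apply_of, if_true, hji, if_false] at h2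
    revert h2
    decide
  have hcyc : IsCyclic (FreeGroup (IsFreeGroup.Generators S)) := by
    rcases isEmpty_or_nonempty (IsFreeGroup.Generators S) with h | h
    · infer_instance
    · have : Unique (IsFreeGroup.Generators S) :=
        { default := h.some, uniq := fun _ => Subsingleton.elim _ _ }
      infer_instance
  obtain ⟨r, hr⟩ := hcyc.exists_generator
  have key : ∀ s : S, ∃ k : ℤ, ((e.symm r : S) : F2) ^ k = s := by
    intro s
    obtain ⟨k, hk⟩ := hr (e s)
    refine ⟨k, ?_⟩
    have := congrArg e.symm hk
    simp only [map_zpow, MulEquiv.symm_apply_apply] at this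
    exact_mod_cast congrArg Subtype.val this
  obtain ⟨m, hm⟩ := key ⟨a, Subgroup.subset_closure (by simp)⟩
  obtain ⟨k, hk⟩ := key ⟨cc, Subgroup.subset_closure (by simp)⟩
  simp only at hm hk
  have hk2 := congrArg chi hk
  rw [map_zpow, chi_cc] at hk2
  have hk3 := congrArg Multiplicative.toAdd hk2
  simp only [toAdd_zpow, toAdd_ofAdd, smul_eq_mul] at hk3
  have hk4 : k * k = 1 := by
    rcases Int.isUnit_iff.1 (IsUnit.of_mul_eq_one (-(Multiplicative.toAdd (chi (e.symm r : S)))) (by linarith : k * _ = 1)) with h | h <;> simp [h]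
  refine ⟨k * m, ?_⟩
  rw [← hk, ← zpow_mul, ← mul_assoc, hk4, one_mul, hm]

end Prelim

section Dynamics

open Filter

abbrev VV := {v : ℤ × ℤ // Odd (v.1 + v.2)}

def sx : Equiv.Perm VV where
  toFun v := ⟨(v.1.1 + 2 * v.1.2, v.1.2), by have := v.2; grind⟩
  invFun v := ⟨(v.1.1 - 2 * v.1.2, v.1.2), by have := v.2; grind⟩
  left_inv v := by ext <;> simp
  right_inv v := by ext <;> simp

def sy : Equiv.Perm VV where
  toFun v := ⟨(v.1.1, v.1.2 + 2 * v.1.1), by have := v.2; grind⟩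
  invFun v := ⟨(v.1.1, v.1.2 - 2 * v.1.1), by have := v.2; grind⟩
  left_inv v := by ext <;> simp
  right_inv v := by ext <;> simp

def theta : F2 →* Equiv.Perm VV := FreeGroup.lift ![sx, sy]

lemma theta_px : theta px = sx := by simp [theta, px]
lemma theta_py : theta py = sy := by simp [theta, py]

def setX : Fin 2 → Set VV := ![
  {v | (v.1.2 < v.1.1 ∧ 0 ≤ v.1.2) ∨ (v.1.1 < v.1.2 ∧ v.1.2 ≤ 0)},
  {v | (v.1.1 < v.1.2 ∧ 0 ≤ v.1.1) ∨ (v.1.2 < v.1.1 ∧ v.1.1 ≤ 0)}]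

def setY : Fin 2 → Set VV := ![
  {v | (-v.1.2 < v.1.1 ∧ v.1.2 < 0) ∨ (v.1.1 < -v.1.2 ∧ 0 < v.1.2)},
  {v | (-v.1.1 < v.1.2 ∧ v.1.1 < 0) ∨ (v.1.2 < -v.1.1 ∧ 0 < v.1.1)}]

lemma theta_inj : Function.Injective theta := by
  have hodd : ∀ v : VV, ∃ k, v.1.1 + v.1.2 = 2 * k + 1 := fun v => v.2
  apply FreeGroup.injective_lift_of_ping_pong ![sx, sy] setX setY
  · intro i
    fin_cases i
    · exact ⟨⟨(1, 0), by decide⟩, by simp [setX]⟩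
    · exact ⟨⟨(0, 1), by decide⟩, by simp [setX]⟩
  · intro i j hij
    rw [Function.onFun, Set.disjoint_left]
    intro v hv hv'
    obtain ⟨k, hk⟩ := hodd v
    fin_cases i <;> fin_cases j <;> simp [setX] at hij hv hv' <;> omega
  · intro i j hij
    rw [Function.onFun, Set.disjoint_left]
    intro v hv hv'
    obtain ⟨k, hk⟩ := hodd v
    fin_cases i <;> fin_cases j <;> simp [setY] at hij hv hv' <;> omega
  · intro i j
    rw [Set.disjoint_left]
    intro v hv hv'
    obtain ⟨k, hk⟩ := hodd v
    fin_cases i <;> fin_cases j <;> simp [setX, setY] at hv hv' <;> omega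
  · intro i
    rintro _ ⟨v, hv, rfl⟩
    obtain ⟨k, hk⟩ := hodd v
    fin_cases i
    · simp only [setX, setY] at hv ⊢
      simp [sx] at hv ⊢
      omega
    · simp only [setX, setY] at hv ⊢
      simp [sy] at hv ⊢
      omega
  · intro i
    rintro _ ⟨v, hv, rfl⟩
    obtain ⟨k, hk⟩ := hodd v
    fin_cases i
    · simp only [setX, setY] at hv ⊢
      simp [sx, Equiv.Perm.inv_def] at hv ⊢
      omega
    · simp only [setX, setY] at hv ⊢
      simp [sy, Equiv.Perm.inv_def] at hv ⊢
      omega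

lemma theta_lin (w : F2) : ∃ a b c d : ℤ, ∀ v : VV,
    (theta w v).1 = (a * v.1.1 + b * v.1.2, c * v.1.1 + d * v.1.2) := by
  induction w using FreeGroup.induction_on with
  | C1 => exact ⟨1, 0, 0, 1, fun v => by simp⟩
  | of i =>
    fin_cases i
    · exact ⟨1, 2, 0, 1, fun v => by simp [theta, sx]⟩
    · exact ⟨1, 0, 2, 1, fun v => by simp [theta, sy, add_comm]⟩
  | inv_of i ih =>
    fin_cases i
    · exact ⟨1, -2, 0, 1, fun v => by simp [theta, sx, Equiv.Perm.inv_def, sub_eq_add_neg]⟩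
    · exact ⟨1, 0, -2, 1, fun v => by
        simp [theta, sy, Equiv.Perm.inv_def, sub_eq_add_neg, add_comm]⟩
  | mul x y hx hy =>
    obtain ⟨a, b, c, d, h⟩ := hx
    obtain ⟨a', b', c', d', h'⟩ := hy
    refine ⟨a * a' + b * c', a * b' + b * d', c * a' + d * c', c * b' + d * d', fun v => ?_⟩
    rw [map_mul, Equiv.Perm.mul_apply, h, h']
    ext <;> ring

lemma theta_cc (v : VV) : (theta cc v).1 = (41 * v.1.1 - 18 * v.1.2, 16 * v.1.1 - 7 * v.1.2) := by
  simp only [cc, map_mul, map_inv, theta_px, theta_py, Equiv.Perm.mul_apply]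
  simp only [sx, sy, Equiv.Perm.inv_def, Equiv.coe_fn_mk, Equiv.coe_fn_symm_mk]
  ext <;> ring

noncomputable def al (v : VV) : ℝ := 4 * v.1.1 + (-6 + 3 * √2) * v.1.2
noncomputable def be (v : VV) : ℝ := 4 * v.1.1 + (-6 - 3 * √2) * v.1.2
noncomputable def lam : ℝ := 17 + 12 * √2

lemma s2 : √2 * √2 = (2 : ℝ) := Real.mul_self_sqrt (by norm_num)

lemma irr_lin {a b : ℤ} (h : (a : ℝ) + b * √2 = 0) : a = 0 ∧ b = 0 := by
  have hb : b = 0 := by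
    by_contra hb
    apply irrational_sqrt_two
    refine ⟨(-a : ℚ) / b, ?_⟩
    have : (b : ℝ) ≠ 0 := by exact_mod_cast hb
    push_cast
    field_simp
    linarith
  subst hb
  simpa using h

lemma al_ne (v : VV) : al v ≠ 0 := by
  intro h
  have := irr_lin (a := 4 * v.1.1 - 6 * v.1.2) (b := 3 * v.1.2) (by
    push_cast; rw [al] at h; linarith)
  obtain ⟨k, hk⟩ := v.2
  omega

lemma be_ne (v : VV) : be v ≠ 0 := by
  intro h
  have := irr_lin (a := 4 * v.1.1 - 6 * v.1.2) (b := -3 * v.1.2) (by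
    push_cast; rw [be] at h; linarith)
  obtain ⟨k, hk⟩ := v.2
  omega

lemma lam_gt : 1 < lam := by
  have := Real.sqrt_nonneg 2
  rw [lam]; linarith

lemma al_cc (v : VV) : al (theta cc v) = lam * al v := by
  have := s2
  simp only [al, theta_cc, lam]
  push_cast
  linear_combination (-36 * (v.1.2 : ℝ)) * this

lemma be_cc (v : VV) : lam * be (theta cc v) = be v := by
  have := s2
  simp only [be, theta_cc, lam]
  push_cast
  grind

lemma al_pow (n : ℕ) (v : VV) : al (theta (cc ^ n) v) = lam ^ n * al v := by
  induction n with
  | zero => simp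
  | succ n ih => rw [pow_succ', map_mul, Equiv.Perm.mul_apply, al_cc, ih]; ring

lemma be_pow (n : ℕ) (v : VV) : lam ^ n * be (theta (cc ^ n) v) = be v := by
  induction n with
  | zero => simp
  | succ n ih =>
    rw [pow_succ' cc, map_mul, Equiv.Perm.mul_apply, pow_succ, mul_assoc, be_cc, ih]

lemma al_pow_inv (n : ℕ) (v : VV) : lam ^ n * al (theta (cc ^ n)⁻¹ v) = al v := by
  have := al_pow n (theta (cc ^ n)⁻¹ v)
  rw [← Equiv.Perm.mul_apply, ← map_mul, mul_inv_cancel, map_one] at this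
  simpa using this.symm

lemma be_pow_inv (n : ℕ) (v : VV) : be (theta (cc ^ n)⁻¹ v) = lam ^ n * be v := by
  have := be_pow n (theta (cc ^ n)⁻¹ v)
  rw [← Equiv.Perm.mul_apply, ← map_mul, mul_inv_cancel, map_one] at this
  simpa using this.symm

/-- Matrix of an element in eigen-coordinates; off-diagonal entries do not vanish. -/
lemma eigen_coords (a : F2) (ha : ¬ Commute a cc) : ∃ P Q Q' P' : ℝ, Q ≠ 0 ∧ Q' ≠ 0 ∧
    ∀ v, al (theta a v) = P * al v + Q * be v ∧ be (theta a v) = Q' * al v + P' * be v := by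
  obtain ⟨n00, n01, n10, n11, h⟩ := theta_lin a
  have hs := s2
  have hcom : ¬ (n11 = n00 - 3 * n10 ∧ 8 * n01 = -9 * n10) := by
    rintro ⟨h1, h2⟩
    apply ha
    apply theta_inj
    rw [map_mul, map_mul]
    apply Equiv.ext
    intro v
    apply Subtype.ext
    rw [Equiv.Perm.mul_apply, Equiv.Perm.mul_apply, h, theta_cc, theta_cc, h]
    ext
    · subst h1
      linear_combination (2 * v.1.1 - 6 * v.1.2) * h2
    · subst h1
      linear_combination (-2 * v.1.2) * h2
  have hpos : √2 ≠ (0:ℝ) := by positivity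
  set m : ℝ := -6 + 3 * √2 with hm
  set m' : ℝ := -6 - 3 * √2 with hm'
  have hmm : m' - m ≠ 0 := by
    have : m' - m = -6 * √2 := by rw [hm, hm']; ring
    rw [this]; positivity
  let r0 : ℝ := 4 * n00 + m * n10
  let r1 : ℝ := 4 * n01 + m * n11
  let t0 : ℝ := 4 * n00 + m' * n10
  let t1 : ℝ := 4 * n01 + m' * n11
  refine ⟨(m' * r0 / 4 - r1) / (m' - m), (r1 - m * r0 / 4) / (m' - m),
    (m' * t0 / 4 - t1) / (m' - m), (t1 - m * t0 / 4) / (m' - m), ?_, ?_, ?_⟩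
  · refine div_ne_zero ?_ hmm
    intro h0
    have := irr_lin (a := 16 * n01 - 24 * n11 + 24 * n00 - 54 * n10)
      (b := 12 * n11 - 12 * n00 + 36 * n10) (by
        push_cast
        simp only [r0, r1, hm] at h0
        linear_combination 4 * h0 + 9 * n10 * hs)
    omega
  · refine div_ne_zero ?_ hmm
    intro h0
    have := irr_lin (a := 16 * n01 - 24 * n11 + 24 * n00 - 54 * n10)
      (b := -(12 * n11 - 12 * n00 + 36 * n10)) (by
        push_cast
        simp only [t0, t1, hm'] at h0
        linear_combination -4 * h0 + 9 * n10 * hs)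
    omega
  · intro v
    constructor
    · simp only [al, be, h, ← hm, ← hm', r0, r1]
      field_simp
      push_cast
      ring
    · simp only [al, be, h, ← hm, ← hm', t0, t1]
      field_simp
      push_cast
      ring

def PA (s : ℕ → VV) : Prop := ∀ ε > 0, ∀ᶠ n in atTop, |be (s n)| ≤ ε * |al (s n)|
def PB (s : ℕ → VV) : Prop := ∃ K > 0, ∀ᶠ n in atTop, |al (s n)| ≤ K * |be (s n)|

lemma stepB (b : F2) (hb : ¬ Commute b cc) (s : ℕ → VV) (hs : PA s) :
    PB (fun n => theta b (s n)) := by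
  obtain ⟨P, Q, Q', P', hQ, hQ', h⟩ := eigen_coords b hb
  have hq : 0 < |Q'| := abs_pos.2 hQ'
  let ε := |Q'| / (2 * (|P'| + 1))
  have hε : 0 < ε := by positivity
  have hε2 : |P'| * ε ≤ |Q'| / 2 := by
    have : (|P'| + 1) * ε = |Q'| / 2 := by simp only [ε]; field_simp
    nlinarith [abs_nonneg P']
  refine ⟨(|P| + |Q| * ε) * 2 / |Q'| + 1, by positivity, ?_⟩
  filter_upwards [hs ε hε] with n hn
  rw [(h _).1, (h _).2]
  set A := al (s n)
  set B := be (s n)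
  have h1 : |P * A + Q * B| ≤ (|P| + |Q| * ε) * |A| := by
    calc _ ≤ |P * A| + |Q * B| := abs_add_le _ _
      _ = |P| * |A| + |Q| * |B| := by rw [abs_mul, abs_mul]
      _ ≤ |P| * |A| + |Q| * (ε * |A|) := by gcongr
      _ = _ := by ring
  have h2 : |Q'| / 2 * |A| ≤ |Q' * A + P' * B| := by
    have e1 : |Q'| * |A| ≤ |Q' * A + P' * B| + |P'| * |B| := by
      rw [← abs_mul, ← abs_mul]
      calc |Q' * A| = |(Q' * A + P' * B) - P' * B| := by ring_nf
        _ ≤ _ := abs_sub _ _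
    have e2 : |P'| * |B| ≤ |Q'| / 2 * |A| := by
      calc |P'| * |B| ≤ |P'| * (ε * |A|) := by gcongr
        _ = |P'| * ε * |A| := by ring
        _ ≤ _ := by gcongr
    linarith
  calc _ ≤ (|P| + |Q| * ε) * |A| := h1
    _ = (|P| + |Q| * ε) * 2 / |Q'| * (|Q'| / 2 * |A|) := by field_simp
    _ ≤ (|P| + |Q| * ε) * 2 / |Q'| * |Q' * A + P' * B| := by gcongr
    _ ≤ _ := by gcongr; linarith

/-- The mirror image of `stepB`. -/
lemma stepA0 (b : F2) (hb : ¬ Commute b cc) (s : ℕ → VV)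
    (hs : ∀ ε > 0, ∀ᶠ n in atTop, |al (s n)| ≤ ε * |be (s n)|) :
    ∃ K > 0, ∀ᶠ n in atTop, |be (theta b (s n))| ≤ K * |al (theta b (s n))| := by
  obtain ⟨P', Q', Q, P, hQ', hQ, h⟩ := eigen_coords b hb
  have hq : 0 < |Q'| := abs_pos.2 hQ'
  let ε := |Q'| / (2 * (|P'| + 1))
  have hε : 0 < ε := by positivity
  have hε2 : |P'| * ε ≤ |Q'| / 2 := by
    have : (|P'| + 1) * ε = |Q'| / 2 := by simp only [ε]; field_simp
    nlinarith [abs_nonneg P']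
  refine ⟨(|P| + |Q| * ε) * 2 / |Q'| + 1, by positivity, ?_⟩
  filter_upwards [hs ε hε] with n hn
  rw [(h _).1, (h _).2, add_comm (Q * _), add_comm (P' * _)]
  set B := al (s n)
  set A := be (s n)
  have h1 : |P * A + Q * B| ≤ (|P| + |Q| * ε) * |A| := by
    calc _ ≤ |P * A| + |Q * B| := abs_add_le _ _
      _ = |P| * |A| + |Q| * |B| := by rw [abs_mul, abs_mul]
      _ ≤ |P| * |A| + |Q| * (ε * |A|) := by gcongr
      _ = _ := by ring
  have h2 : |Q'| / 2 * |A| ≤ |Q' * A + P' * B| := by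
    have e1 : |Q'| * |A| ≤ |Q' * A + P' * B| + |P'| * |B| := by
      rw [← abs_mul, ← abs_mul]
      calc |Q' * A| = |(Q' * A + P' * B) - P' * B| := by ring_nf
        _ ≤ _ := abs_sub _ _
    have e2 : |P'| * |B| ≤ |Q'| / 2 * |A| := by
      calc |P'| * |B| ≤ |P'| * (ε * |A|) := by gcongr
        _ = |P'| * ε * |A| := by ring
        _ ≤ _ := by gcongr
    linarith
  calc _ ≤ (|P| + |Q| * ε) * |A| := h1
    _ = (|P| + |Q| * ε) * 2 / |Q'| * (|Q'| / 2 * |A|) := by field_simp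
    _ ≤ (|P| + |Q| * ε) * 2 / |Q'| * |Q' * A + P' * B| := by gcongr
    _ ≤ _ := by gcongr; linarith

lemma lam_big (K : ℝ) (ε : ℝ) (hε : 0 < ε) : ∀ᶠ n : ℕ in atTop, K ≤ ε * lam ^ n := by
  have := (tendsto_pow_atTop_atTop_of_one_lt lam_gt).const_mul_atTop hε
  exact this.eventually_ge_atTop K

lemma stepA (a : F2) (ha : ¬ Commute a cc) (s : ℕ → VV) (hs : PB s) :
    PA (fun n => theta (cc ^ n * a * (cc ^ n)⁻¹) (s n)) := by
  have hl : ∀ n : ℕ, 1 ≤ lam ^ n := fun n => one_le_pow₀ lam_gt.le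
  have hl' : ∀ n : ℕ, |lam ^ n| = lam ^ n := fun n => abs_of_nonneg (by linarith [hl n])
  obtain ⟨K, hK, hs⟩ := hs
  have h1 : ∀ ε > 0, ∀ᶠ n in atTop, |al (theta (cc ^ n)⁻¹ (s n))| ≤
      ε * |be (theta (cc ^ n)⁻¹ (s n))| := by
    intro ε hε
    filter_upwards [hs, lam_big K ε hε] with n hn hn2
    have e := al_pow_inv n (s n)
    rw [be_pow_inv, abs_mul, hl']
    rw [← e, abs_mul, hl'] at hn
    have := abs_nonneg (al (theta (cc ^ n)⁻¹ (s n)))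
    calc |al (theta (cc ^ n)⁻¹ (s n))| ≤ lam ^ n * |al (theta (cc ^ n)⁻¹ (s n))| := by
          nlinarith [hl n]
      _ ≤ K * |be (s n)| := hn
      _ ≤ ε * lam ^ n * |be (s n)| := by gcongr
      _ = _ := by ring
  obtain ⟨K', hK', h2⟩ := stepA0 a ha _ h1
  intro ε hε
  filter_upwards [h2, lam_big K' ε hε] with n hn hn2
  rw [map_mul, map_mul, Equiv.Perm.mul_apply, Equiv.Perm.mul_apply, al_pow, abs_mul, hl']
  set t := theta a (theta (cc ^ n)⁻¹ (s n))
  have e := be_pow n t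
  rw [← e, abs_mul, hl'] at hn
  have := abs_nonneg (be (theta (cc ^ n) t))
  calc |be (theta (cc ^ n) t)| ≤ lam ^ n * |be (theta (cc ^ n) t)| := by nlinarith [hl n]
    _ ≤ K' * |al t| := hn
    _ ≤ ε * lam ^ n * |al t| := by gcongr
    _ = _ := by ring

lemma PB_const (v : VV) : PB (fun _ => v) := by
  have := abs_pos.2 (be_ne v)
  have := abs_pos.2 (al_ne v)
  refine ⟨|al v| / |be v|, by positivity, Eventually.of_forall fun n => ?_⟩
  field_simp
  exact le_rfl

lemma PA_ne (s : ℕ → VV) (hs : PA s) (v : VV) : ∀ᶠ n in atTop, s n ≠ v := by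
  have h1 := abs_pos.2 (be_ne v)
  have h2 := abs_pos.2 (al_ne v)
  filter_upwards [hs (|be v| / (2 * |al v|)) (by positivity)] with n hn h
  rw [h] at hn
  have : |be v| / (2 * |al v|) * |al v| = |be v| / 2 := by field_simp
  linarith

end Dynamics

section Amalgam

open Filter

def ff (n : ℕ) : F3 →* F2 :=
  FreeGroup.lift ![cc ^ n * px * (cc ^ n)⁻¹, cc ^ n * py * (cc ^ n)⁻¹, uu]

def jB : F2 →* F3 := FreeGroup.lift ![inc cc, gZ]

lemma ff_inc (n : ℕ) (a : F2) : ff n (inc a) = cc ^ n * a * (cc ^ n)⁻¹ := by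
  have : (ff n).comp inc = (MulAut.conj (cc ^ n)).toMonoidHom := by
    refine FreeGroup.ext_hom _ _ fun i => ?_
    fin_cases i <;> simp [ff, inc, px, py, -map_pow]
  exact DFunLike.congr_fun this a

lemma ff_jB (n : ℕ) (b : F2) : ff n (jB b) = tau b := by
  have : (ff n).comp jB = tau := by
    refine FreeGroup.ext_hom _ _ fun i => ?_
    fin_cases i
    · simp [jB, tau, ff_inc]
      group
    · simp [jB, tau, ff, gZ]
  exact DFunLike.congr_fun this b

lemma hh_eq : hh = inc cc * gZ * gZ := by
  simp [hh, cc]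

lemma ff_hh (n : ℕ) : ff n hh = px := by
  have : ff n gZ = uu := by simp [ff, gZ]
  rw [hh_eq, map_mul, map_mul, ff_inc, this]
  have : cc ^ n * cc * (cc ^ n)⁻¹ = cc := by group
  rw [this, cc, uu]
  group

inductive Alt : Bool → F3 → Prop
  | a1 (a : F2) (ha : ¬ Commute a cc) : Alt true (inc a)
  | b1 (b : F2) (hb : ¬ Commute (tau b) cc) : Alt false (jB b)
  | ac (a : F2) (ha : ¬ Commute a cc) (w : F3) (hw : Alt false w) : Alt true (inc a * w)
  | bc (b : F2) (hb : ¬ Commute (tau b) cc) (w : F3) (hw : Alt true w) : Alt false (jB b * w)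

lemma alt_dyn {s : Bool} {w : F3} (h : Alt s w) (v : VV) :
    (s = true → PA (fun n => theta (ff n w) v)) ∧ (s = false → PB (fun n => theta (ff n w) v)) := by
  induction h with
  | a1 a ha =>
    refine ⟨fun _ => ?_, by simp⟩
    simp only [ff_inc]
    exact stepA a ha _ (PB_const v)
  | b1 b hb =>
    refine ⟨by simp, fun _ => ?_⟩
    simp only [ff_jB]
    exact PB_const _
  | ac a ha w hw ih =>
    refine ⟨fun _ => ?_, by simp⟩
    have := stepA a ha _ (ih.2 rfl)
    simpa only [map_mul, ff_inc, Equiv.Perm.mul_apply] using this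
  | bc b hb w hw ih =>
    refine ⟨by simp, fun _ => ?_⟩
    have := stepB (tau b) hb _ (ih.1 rfl)
    simpa only [map_mul, ff_jB, Equiv.Perm.mul_apply] using this

lemma alt_ne {s : Bool} {w : F3} (h : Alt s w) : ∀ᶠ n in atTop, ff n w ≠ 1 := by
  let v : VV := ⟨(1, 0), by decide⟩
  have hA : ∀ w, Alt true w → ∀ v', ∀ᶠ n in atTop, theta (ff n w) v ≠ v' :=
    fun w hw v' => PA_ne _ ((alt_dyn hw v).1 rfl) v'
  have hA' : ∀ w, Alt true w → ∀ᶠ n in atTop, ff n w ≠ 1 := by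
    intro w hw
    filter_upwards [hA w hw v] with n hn h
    rw [h] at hn
    simp at hn
  cases h with
  | a1 a ha => exact hA' _ (Alt.a1 a ha)
  | ac a ha w hw => exact hA' _ (Alt.ac a ha w hw)
  | b1 b hb =>
    refine Eventually.of_forall fun n h => hb ?_
    rw [ff_jB] at h
    rw [h]
    exact Commute.one_left _
  | bc b hb w hw =>
    filter_upwards [hA w hw (theta (tau b)⁻¹ v)] with n hn h
    apply hn
    rw [map_mul, ff_jB] at h
    rw [eq_inv_of_mul_eq_one_right h]

/-- Elements in the amalgamated subgroup or with an alternating expression. -/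
def Good (w : F3) : Prop := (∃ k : ℤ, w = inc cc ^ k) ∨ ∃ s, Alt s w

lemma jB_zpow (k : ℤ) : jB (FreeGroup.of 0 ^ k) = inc cc ^ k := by
  simp [jB]

lemma tau_zpow (k : ℤ) : tau (FreeGroup.of 0 ^ k) = cc ^ k := by
  simp [tau]

lemma centB (b : F2) (h : Commute (tau b) cc) : ∃ k : ℤ, b = FreeGroup.of 0 ^ k := by
  obtain ⟨k, hk⟩ := cent _ h
  exact ⟨k, tau_inj (by rw [hk, tau_zpow])⟩

lemma not_comm_mul {a : F2} (ha : ¬ Commute a cc) (k : ℤ) : ¬ Commute (cc ^ k * a) cc := by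
  intro h
  apply ha
  have h2 : Commute (cc ^ (-k)) cc := (Commute.refl cc).zpow_left _
  have := h2.mul_left h
  rwa [← mul_assoc, ← zpow_add, neg_add_cancel, zpow_zero, one_mul] at this

lemma alt_absorb {s : Bool} {w : F3} (h : Alt s w) (k : ℤ) : Alt s (inc cc ^ k * w) := by
  cases h with
  | a1 a ha =>
    rw [← map_zpow, ← map_mul]
    exact Alt.a1 _ (not_comm_mul ha k)
  | b1 b hb =>
    rw [← jB_zpow, ← map_mul]
    exact Alt.b1 _ (by rw [map_mul, tau_zpow]; exact not_comm_mul hb k)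
  | ac a ha w hw =>
    rw [← mul_assoc, ← map_zpow, ← map_mul]
    exact Alt.ac _ (not_comm_mul ha k) _ hw
  | bc b hb w hw =>
    rw [← mul_assoc, ← jB_zpow, ← map_mul]
    exact Alt.bc _ (by rw [map_mul, tau_zpow]; exact not_comm_mul hb k) _ hw

lemma good_inc (a : F2) : Good (inc a) := by
  by_cases h : Commute a cc
  · obtain ⟨k, rfl⟩ := cent a h
    exact Or.inl ⟨k, map_zpow _ _ _⟩
  · exact Or.inr ⟨_, Alt.a1 a h⟩

lemma good_jB (b : F2) : Good (jB b) := by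
  by_cases h : Commute (tau b) cc
  · obtain ⟨k, rfl⟩ := centB b h
    exact Or.inl ⟨k, jB_zpow k⟩
  · exact Or.inr ⟨_, Alt.b1 b h⟩

lemma good_inc_alt (a : F2) (w : F3) (hw : Alt false w) : Good (inc a * w) := by
  by_cases h : Commute a cc
  · obtain ⟨k, rfl⟩ := cent a h
    rw [map_zpow]
    exact Or.inr ⟨_, alt_absorb hw k⟩
  · exact Or.inr ⟨_, Alt.ac a h w hw⟩

lemma good_jB_alt (b : F2) (w : F3) (hw : Alt true w) : Good (jB b * w) := by
  by_cases h : Commute (tau b) cc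
  · obtain ⟨k, rfl⟩ := centB b h
    rw [jB_zpow]
    exact Or.inr ⟨_, alt_absorb hw k⟩
  · exact Or.inr ⟨_, Alt.bc b h w hw⟩

lemma good_inc_mul (a : F2) (w : F3) (hw : Good w) : Good (inc a * w) := by
  rcases hw with ⟨k, rfl⟩ | ⟨s, hw⟩
  · rw [← map_zpow, ← map_mul]
    exact good_inc _
  · cases hw with
    | a1 a' ha => rw [← map_mul]; exact good_inc _
    | ac a' ha w hw => rw [← mul_assoc, ← map_mul]; exact good_inc_alt _ _ hw
    | b1 b hb => exact good_inc_alt _ _ (Alt.b1 b hb)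
    | bc b hb w hw => exact good_inc_alt _ _ (Alt.bc b hb w hw)

lemma good_jB_mul (b : F2) (w : F3) (hw : Good w) : Good (jB b * w) := by
  rcases hw with ⟨k, rfl⟩ | ⟨s, hw⟩
  · rw [← jB_zpow, ← map_mul]
    exact good_jB _
  · cases hw with
    | b1 a' ha => rw [← map_mul]; exact good_jB _
    | bc a' ha w hw => rw [← mul_assoc, ← map_mul]; exact good_jB_alt _ _ hw
    | a1 b hb => exact good_jB_alt _ _ (Alt.a1 b hb)
    | ac b hb w hw => exact good_jB_alt _ _ (Alt.ac b hb w hw)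

lemma good_all (w : F3) : Good w := by
  have key : ∀ g : F3, ∀ w, Good w → Good (g * w) := by
    have hof : ∀ i : Fin 3, (∃ a, FreeGroup.of i = inc a) ∨ (∃ b, FreeGroup.of i = jB b) := by
      intro i
      fin_cases i
      · exact Or.inl ⟨px, by simp [gX]⟩
      · exact Or.inl ⟨py, by simp [gY]⟩
      · exact Or.inr ⟨FreeGroup.of 1, by simp [jB, gZ]⟩
    intro g
    induction g using FreeGroup.induction_on with
    | C1 => simp
    | of i =>
      rcases hof i with ⟨a, h⟩ | ⟨a, h⟩ <;> rw [h]
      · exact good_inc_mul a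
      · exact good_jB_mul a
    | inv_of i ih =>
      rcases hof i with ⟨a, h⟩ | ⟨a, h⟩ <;> rw [h, ← map_inv]
      · exact good_inc_mul _
      · exact good_jB_mul _
    | mul x y hx hy =>
      intro w hw
      rw [mul_assoc]
      exact hx _ (hy _ hw)
  have := key w 1 (Or.inl ⟨0, by simp⟩)
  rwa [mul_one] at this

lemma ff_disc (w : F3) (hw : w ≠ 1) : ∀ᶠ n in atTop, ff n w ≠ 1 := by
  rcases good_all w with ⟨k, rfl⟩ | ⟨s, h⟩
  · refine Eventually.of_forall fun n h => hw ?_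
    rw [← map_zpow, ff_inc, conj_eq_one_iff] at h
    rw [cc_zpow_eq_one h, zpow_zero]
  · exact alt_ne h

end Amalgam


section NonPrim

/-- value of the word h in a group -/
def hval {G : Type*} [Group G] (a b c : G) : G := a * b * a⁻¹ * a⁻¹ * b⁻¹ * c * c

lemma lift_hh {G : Type*} [Group G] (f : F3 →* G) : f hh = hval (f gX) (f gY) (f gZ) := by
  simp [hh, hval]

abbrev D3 := DihedralGroup 3

lemma card_one : (Finset.univ.filter
    (fun p : D3 × D3 × D3 => hval p.1 p.2.1 p.2.2 = 1)).card = 54 := by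
  decide +kernel

lemma card_r : (Finset.univ.filter
    (fun p : D3 × D3 × D3 => hval p.1 p.2.1 p.2.2 = DihedralGroup.r 1)).card = 27 := by
  decide +kernel

def homOf (p : D3 × D3 × D3) : F3 →* D3 := FreeGroup.lift ![p.1, p.2.1, p.2.2]
def ofHom (f : F3 →* D3) : D3 × D3 × D3 := (f gX, f gY, f gZ)
lemma ofHom_homOf (p : D3 × D3 × D3) : ofHom (homOf p) = p := by
  simp [ofHom, homOf, gX, gY, gZ]
lemma ofHom_inj : Function.Injective ofHom := by
  intro f g h
  simp only [ofHom, Prod.mk.injEq] at h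
  refine FreeGroup.ext_hom _ _ fun i => ?_
  fin_cases i
  · exact h.1
  · exact h.2.1
  · exact h.2.2

lemma hh_not_primitive : ¬ IsPrimitiveElement hh := by
  rintro ⟨ι, B, i, hi⟩
  classical
  let T : (F3 →* D3) → (F3 →* D3) := fun f =>
    B.lift (Function.update (fun j => f (B j)) i (DihedralGroup.r 1))
  have hT : ∀ f, T f hh = DihedralGroup.r 1 := by
    intro f
    rw [← hi]
    simp [T]
  have hTinj : ∀ f g, f hh = 1 → g hh = 1 → T f = T g → f = g := by
    intro f g hf hg hfg
    refine B.ext_hom _ _ fun j => ?_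
    by_cases hj : j = i
    · rw [hj, hi, hf, hg]
    · have := DFunLike.congr_fun hfg (B j)
      simpa [T, hj] using this
  have := Finset.card_le_card_of_injOn
    (s := Finset.univ.filter (fun p : D3 × D3 × D3 => hval p.1 p.2.1 p.2.2 = 1))
    (t := Finset.univ.filter
      (fun p : D3 × D3 × D3 => hval p.1 p.2.1 p.2.2 = DihedralGroup.r 1))
    (fun p => ofHom (T (homOf p))) (by
      intro p hp
      have := hT (homOf p)
      rw [lift_hh] at this
      simpa [ofHom] using this) (by
      intro p hp q hq hpq
      have key : ∀ p : D3 × D3 × D3, hval p.1 p.2.1 p.2.2 = 1 → homOf p hh = 1 := by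
        intro p hp
        rw [lift_hh, ← hp]
        simp [homOf, gX, gY, gZ]
      have := hTinj _ _ (key p (by simpa using hp)) (key q (by simpa using hq)) (ofHom_inj hpq)
      rw [← ofHom_homOf p, this, ofHom_homOf])
  rw [card_one, card_r] at this
  omega

end NonPrim
/-- The free group of rank 3 is not `∀`-homogeneous: there are elements `g` and `h` with the
same `∀`-type such that `g` is primitive and `h` is not, and hence no automorphism sends
`h` to `g`. -/
theorem freeGroup_three_not_forall_homogeneous :
    ∃ g h : FreeGroup (Fin 3),
      (∀ φ : Lgp.Formula (Fin 1), IsUniversalF φ →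
        (φ.Realize (fun _ => g) ↔ φ.Realize (fun _ => h))) ∧
      IsPrimitiveElement g ∧
      ¬ IsPrimitiveElement h ∧
      ¬ ∃ e : FreeGroup (Fin 3) ≃* FreeGroup (Fin 3), e h = g := by
  have hprim : IsPrimitiveElement gX :=
    ⟨Fin 3, FreeGroupBasis.ofFreeGroup (Fin 3), 0, by simp [gX]⟩
  refine ⟨gX, hh, fun φ hφ => ⟨fun h => ?_, fun h => ?_⟩, hprim, hh_not_primitive, ?_⟩
  · refine universal_transfer (fun n => inc.comp (ff n)) ?_ hh gX ?_ φ hφ h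
    · intro w hw
      filter_upwards [ff_disc w hw] with n hn h
      exact hn (inc_inj (by simpa using h))
    · intro n
      simp [ff_hh]
  · refine universal_transfer (fun _ => phi) ?_ gX hh (fun _ => phi_X) φ hφ h
    intro w hw
    refine Filter.Eventually.of_forall fun n h => hw (phi_inj (by simpa using h))
  · rintro ⟨e, he⟩
    obtain ⟨ι, B, i, hi⟩ := hprim
    apply hh_not_primitive
    exact ⟨ι, B.map e.symm, i, by simp [hi, ← he]⟩
end

section
/- The free group F_ω of countably infinite rank is not ∀-homogeneous: there exist finite tuples ā and b̄ in F_ω of the same length with tp_∀^{F_ω}(ā) = tp_∀^{F_ω}(b̄) such that no automorphism of F_ω sends ā to b̄. -/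
open FirstOrder

namespace NFH

abbrev F := FreeGroup ℕ

section words
open FreeGroup

/-- The word `c ^ m` written out as a list of letters. -/
def pw (L : List (ℕ × Bool)) (m : ℕ) : List (ℕ × Bool) := (List.replicate m L).flatten

lemma pw_zero (L) : pw L 0 = [] := by simp [pw]
lemma pw_succ (L) (m) : pw L (m+1) = L ++ pw L m := by simp [pw, List.replicate_succ]
lemma pw_add (L) (m n) : pw L (m+n) = pw L m ++ pw L n := by
  rw [pw, List.replicate_add, List.flatten_append]; rfl
lemma pw_one (L) : pw L 1 = L := by simp [pw]
lemma pw_succ' (L) (m) : pw L (m+1) = pw L m ++ L := by rw [pw_add, pw_one]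
lemma pw_length (L) (m) : (pw L m).length = m * L.length := by simp [pw]

lemma mk_pw (c : F) (m : ℕ) : mk (pw c.toWord m) = c ^ m := by
  induction m with
  | zero => simp [pw_zero]; rfl
  | succ m ih => rw [pw_succ, ← mul_mk, ih, mk_toWord, pow_succ']

/-- Elements whose reduced word starts with `c ^ m`. -/
def P (c : F) (m : ℕ) : Set F := {x | pw c.toWord m <+: x.toWord}

lemma P_mono {c : F} {m n : ℕ} (h : m ≤ n) : P c n ⊆ P c m := by
  intro x hx
  obtain ⟨k, rfl⟩ := Nat.exists_eq_add_of_le h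
  refine List.IsPrefix.trans ?_ hx
  rw [pw_add]
  exact List.prefix_append _ _

/-- Maximal cancellation. -/
lemma cancel (L₁ : List (ℕ × Bool)) : ∀ (L₂ : List (ℕ × Bool)), IsReduced L₁ → IsReduced L₂ →
    ∃ p s t, L₁ = p ++ s ∧ L₂ = invRev s ++ t ∧ IsReduced (p ++ t) := by
  induction L₁ using List.reverseRecOn with
  | nil => intro L₂ _ h; exact ⟨[], [], L₂, by simp, by simp, by simpa using h⟩
  | append_singleton L a ih =>
    intro L₂ h1 h2
    have hL : IsReduced L := h1.infix ⟨[], [a], by simp⟩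
    cases L₂ with
    | nil => exact ⟨L ++ [a], [], [], by simp, by simp, by simpa using h1⟩
    | cons b L₂ =>
      by_cases hab : a.1 = b.1 ∧ (!a.2) = b.2
      · have h2' : IsReduced L₂ := h2.infix ⟨[b], [], by simp⟩
        obtain ⟨p, s, t, e1, e2, e3⟩ := ih L₂ hL h2'
        refine ⟨p, s ++ [a], t, by simp [e1], ?_, e3⟩
        rw [invRev_append, e2]
        simp [invRev, hab.1, hab.2]
      · refine ⟨L ++ [a], [], b :: L₂, by simp, by simp, ?_⟩
        have : IsReduced ([a] ++ b :: L₂) := by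
          simp only [FreeGroup.IsReduced, List.singleton_append, List.isChain_cons_cons] at h2 ⊢
          refine ⟨?_, h2⟩
          intro h
          by_contra h'
          apply hab
          refine ⟨h, ?_⟩
          cases h3 : a.2 <;> cases h4 : b.2 <;> simp_all
        exact IsReduced.append_overlap h1 this (by simp)

lemma toWord_mk_red {L : List (ℕ × Bool)} (h : IsReduced L) : (mk L : F).toWord = L := by
  rw [toWord_mk, h.reduce_eq]

lemma mk_cancel (p s t : List (ℕ × Bool)) :
    (mk (p ++ s) : F) * mk (invRev s ++ t) = mk (p ++ t) := by
  rw [← mul_mk, ← mul_mk, ← mul_mk, ← inv_mk]; group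

lemma stepA1 {c x : F} (hc : IsCyclicallyReduced c.toWord) (hx : x ∉ P c⁻¹ 1) (i : ℕ) :
    c ^ (i+1) * x ∈ P c i := by
  obtain ⟨p, s, t, e1, e2, e3⟩ := cancel c.toWord x.toWord isReduced_toWord isReduced_toWord
  have hp : p ≠ [] := by
    rintro rfl
    apply hx
    simp only [P, Set.mem_ofPred_eq, pw_one, toWord_inv, e1, e2]
    simp
  have hcx : c * x = mk (p ++ t) := by
    rw [← mk_cancel p s t, ← e1, ← e2, mk_toWord, mk_toWord]
  have hr : IsReduced (pw c.toWord i ++ p ++ t) := by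
    refine IsReduced.append_overlap ?_ e3 hp
    have := (hc.flatten_replicate (i+1)).isReduced
    change IsReduced (pw _ _) at this
    rw [pw_succ'] at this
    nth_rewrite 2 [e1] at this
    exact this.infix ⟨[], s, by simp⟩
  have : c ^ (i+1) * x = mk (pw c.toWord i ++ p ++ t) := by
    rw [pow_succ, mul_assoc, hcx, List.append_assoc, ← mul_mk (L₂ := p ++ t), mk_pw]
  simp only [P, Set.mem_ofPred_eq, this, toWord_mk_red hr]
  simp

lemma stepA {c : F} (hc : IsCyclicallyReduced c.toWord) (m : ℕ) : ∀ (x : F) (k : ℕ),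
    x ∉ P c⁻¹ m → c ^ (m+k) * x ∈ P c k := by
  induction m with
  | zero => intro x k hx; exact absurd (by simp [P, pw_zero]) hx
  | succ m ih =>
    intro x k hx
    by_cases h1 : x ∈ P c⁻¹ 1
    · obtain ⟨t, ht⟩ := h1
      have ht' : IsReduced t := (isReduced_toWord (x := x)).infix ⟨_, [], by rw [List.append_nil]; exact ht⟩
      have hx' : x = c⁻¹ * mk t := by
        rw [← mk_toWord (x := x), ← ht, ← mul_mk, mk_pw, pow_one]
      have := ih (mk t) k ?_
      · rw [hx', show m + 1 + k = m + k + 1 by ring, pow_succ]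
        simpa [mul_assoc] using this
      · rintro ⟨t', h'⟩
        apply hx
        refine ⟨t', ?_⟩
        rw [toWord_mk_red ht'] at h'
        rw [pw_succ, List.append_assoc, h', ← ht, pw_one]
    · have := stepA1 hc h1 (m + k)
      rw [show m + 1 + k = m + k + 1 by ring]
      exact P_mono (by omega) this

lemma stepC {c : F} (hc : c ≠ 1) (g : F) : g ∉ P c (g.toWord.length + 1) := by
  intro h
  have h1 := h.length_le
  rw [pw_length] at h1
  have : 0 < c.toWord.length := by
    rw [List.length_pos_iff]; simpa using hc
  nlinarith

lemma stepB {c : F} (hc : c ≠ 1) (g : F) (hg : ¬ Commute g c) :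
    ∃ m, ∀ x ∈ P c m, g * x ∉ P c m := by
  set K := g.toWord.length with hK
  set l := c.toWord.length with hl
  have hl0 : 0 < l := by
    rw [hl, List.length_pos_iff]; simpa using hc
  refine ⟨2 * K + 1, fun x hx hgx => hg ?_⟩
  obtain ⟨p, s, t, e1, e2, e3⟩ := cancel g.toWord x.toWord isReduced_toWord isReduced_toWord
  have hgx' : (g * x).toWord = p ++ t := by
    rw [← toWord_mk_red e3, ← mk_cancel p s t, ← e1, ← e2, mk_toWord, mk_toWord]
  have hlen : p.length + s.length = K := by rw [hK, e1]; simp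
  have key : ∀ i, K ≤ i → i ≤ 2 * K + 1 → ∃ t1, t1 <+: t ∧ pw c.toWord i = invRev s ++ t1 := by
    intro i h1 h2
    have hpx : pw c.toWord i <+: x.toWord := P_mono h2 hx
    have hs : invRev s <+: x.toWord := by rw [e2]; simp
    have : invRev s <+: pw c.toWord i := by
      refine List.prefix_of_prefix_length_le hs hpx ?_
      rw [pw_length, invRev_length]; nlinarith
    obtain ⟨t1, ht1⟩ := this
    refine ⟨t1, ?_, ht1.symm⟩
    rw [← ht1, e2] at hpx
    exact (List.prefix_append_right_inj _).1 hpx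
  obtain ⟨t1, ht1, h1⟩ := key K le_rfl (by omega)
  obtain ⟨t2, ht2, h2⟩ := key (K+1) (by omega) (by omega)
  have l1 := congrArg List.length h1
  have l2 := congrArg List.length h2
  rw [pw_length, List.length_append, invRev_length] at l1 l2
  have g1 : g * c ^ K = mk (p ++ t1) := by
    rw [← mk_cancel p s t1, ← e1, ← h1, mk_toWord, mk_pw]
  have g2 : g * c ^ (K+1) = mk (p ++ t2) := by
    rw [← mk_cancel p s t2, ← e1, ← h2, mk_toWord, mk_pw]
  have hgx2 : pw c.toWord (2*K+1) <+: p ++ t := by rw [← hgx']; exact hgx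
  have q1 : p ++ t1 <+: pw c.toWord (2*K+1) := by
    refine List.prefix_of_prefix_length_le ((List.prefix_append_right_inj _).2 ht1) hgx2 ?_
    rw [pw_length, List.length_append]; nlinarith
  have q2 : p ++ t2 <+: pw c.toWord (2*K+1) := by
    refine List.prefix_of_prefix_length_le ((List.prefix_append_right_inj _).2 ht2) hgx2 ?_
    rw [pw_length, List.length_append]; nlinarith
  have q1' : c.toWord ++ (p ++ t1) <+: pw c.toWord (2*K+1+1) := by
    rw [pw_succ]; exact (List.prefix_append_right_inj _).2 q1
  have q2' : p ++ t2 <+: pw c.toWord (2*K+1+1) := by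
    rw [pw_succ']; exact q2.trans (List.prefix_append _ _)
  have : c.toWord ++ (p ++ t1) = p ++ t2 := by
    have hle : (c.toWord ++ (p ++ t1)).length = (p ++ t2).length := by
      simp only [List.length_append]; rw [← hl]; linarith
    exact (List.prefix_of_prefix_length_le q1' q2' hle.le).eq_of_length hle
  have h3 : c * (g * c ^ K) = g * c ^ (K+1) := by
    rw [g1, g2, ← this, ← mul_mk (L₂ := p ++ t1), mk_toWord]
  rw [pow_succ', ← mul_assoc, ← mul_assoc] at h3
  exact (mul_right_cancel h3).symm

end words

/-- Commuting with an element which maps to a generator of `ℤ`. -/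
lemma centralizer_cyclic (c g : F) (χ : F →* Multiplicative ℤ)
    (hχ : χ c = Multiplicative.ofAdd 1) (h : Commute g c) : g ∈ Subgroup.zpowers c := by
  let H : Subgroup F := Subgroup.closure {g, c}
  have hcomm : ∀ x y : H, x * y = y * x := by
    have : ∀ x ∈ ({g, c} : Set F), ∀ y ∈ ({g, c} : Set F), x * y = y * x := by
      rintro x (rfl | rfl) y (rfl | rfl)
      · rfl
      · exact h
      · exact h.symm
      · rfl
    have := Subgroup.isMulCommutative_closure this
    intro x y
    exact this.is_comm.comm x y
  have hsub : Subsingleton (IsFreeGroup.Generators H) := by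
    classical
    constructor
    intro i j
    have h1 : FreeGroup.of i * FreeGroup.of j = FreeGroup.of j * FreeGroup.of i := by
      apply (IsFreeGroup.mulEquiv H).injective
      rw [map_mul, map_mul, hcomm]
    have h2 := congrArg FreeGroup.toWord h1
    by_contra hij
    have e1 : FreeGroup.of i * FreeGroup.of j = FreeGroup.mk [(i,true),(j,true)] := rfl
    have e2 : FreeGroup.of j * FreeGroup.of i = FreeGroup.mk [(j,true),(i,true)] := rfl
    rw [e1, e2, FreeGroup.toWord_mk, FreeGroup.toWord_mk] at h2
    simp [FreeGroup.reduce.cons, FreeGroup.reduce_nil] at h2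
    exact hij h2.1
  have hd : ∃ d : H, ∀ x : H, x ∈ Subgroup.zpowers d := by
    rcases isEmpty_or_nonempty (IsFreeGroup.Generators H) with he | ⟨⟨i⟩⟩
    · refine ⟨1, fun x => ?_⟩
      have : x = IsFreeGroup.mulEquiv H 1 := by
        rw [← (IsFreeGroup.mulEquiv H).apply_symm_apply x]
        congr 1
        exact Subsingleton.elim _ _
      rw [this, map_one]; exact one_mem _
    · refine ⟨IsFreeGroup.mulEquiv H (FreeGroup.of i), fun x => ?_⟩
      rw [← (IsFreeGroup.mulEquiv H).apply_symm_apply x]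
      generalize (IsFreeGroup.mulEquiv H).symm x = y
      induction y using FreeGroup.induction_on with
      | C1 => rw [map_one]; exact one_mem _
      | of j => rw [Subsingleton.elim j i]; exact Subgroup.mem_zpowers _
      | inv_of j hj => rw [map_inv]; exact inv_mem hj
      | mul a b ha hb => rw [map_mul]; exact mul_mem ha hb
  obtain ⟨d, hd⟩ := hd
  obtain ⟨k, hk⟩ := hd ⟨c, Subgroup.subset_closure (by simp)⟩
  obtain ⟨l, hl⟩ := hd ⟨g, Subgroup.subset_closure (by simp)⟩
  have hk' : (d : F) ^ k = c := by simpa using congrArg Subtype.val hk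
  have hl' : (d : F) ^ l = g := by simpa using congrArg Subtype.val hl
  have h1 : k * Multiplicative.toAdd (χ d) = 1 := by
    have := congrArg Multiplicative.toAdd (congrArg χ hk')
    rw [hχ, map_zpow] at this
    simpa using this
  rcases Int.isUnit_iff.1 (IsUnit.of_mul_eq_one _ h1) with rfl | rfl
  · rw [zpow_one] at hk'
    exact ⟨l, by simpa [hk'] using hl'⟩
  · rw [zpow_neg, zpow_one] at hk'
    exact ⟨-l, by simpa [← hk'] using hl'⟩

/-- A square of a generator together with another generator generate freely. -/
lemma square_free (h : FreeGroup Bool →* F) (h0 : h (FreeGroup.of true) = (FreeGroup.of 2)⁻¹)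
    (h1 : h (FreeGroup.of false) = FreeGroup.of 1 ^ 2) : Function.Injective h := by
  let x : FreeGroup Bool := FreeGroup.of false
  let y : FreeGroup Bool := FreeGroup.of true
  let U : Equiv.Perm (FreeGroup Bool × Bool) :=
    { toFun := fun p => if p.2 then (p.1, false) else (x * p.1, true)
      invFun := fun p => if p.2 then (x⁻¹ * p.1, false) else (p.1, true)
      left_inv := by rintro ⟨g, _ | _⟩ <;> simp
      right_inv := by rintro ⟨g, _ | _⟩ <;> simp }
  let V : Equiv.Perm (FreeGroup Bool × Bool) :=
    { toFun := fun p => (y * p.1, p.2)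
      invFun := fun p => (y⁻¹ * p.1, p.2)
      left_inv := by rintro ⟨g, _⟩; simp
      right_inv := by rintro ⟨g, _⟩; simp }
  let θ : F →* Equiv.Perm (FreeGroup Bool × Bool) :=
    FreeGroup.lift (fun i => if i = 1 then U else if i = 2 then V⁻¹ else 1)
  have key : ∀ s : FreeGroup Bool, ∀ p, θ (h s) p = (s * p.1, p.2) := by
    intro s
    induction s using FreeGroup.induction_on with
    | C1 => simp
    | of j =>
      rintro ⟨g, b⟩
      cases j
      · rw [h1, map_pow]
        cases b <;> simp [θ, U, pow_two, x]
      · rw [h0, map_inv]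
        simp [θ, V, y]
    | inv_of j hj =>
      rintro ⟨g, b⟩
      rw [map_inv, map_inv, Equiv.Perm.inv_eq_iff_eq, hj]
      simp
    | mul a b ha hb =>
      intro p
      rw [map_mul, map_mul, Equiv.Perm.mul_apply, hb, ha, mul_assoc]
  rw [injective_iff_map_eq_one]
  intro s hs
  have := key s (1, true)
  rw [hs, map_one] at this
  simpa using this.symm

/-- Alternating products. -/
inductive Alt (H : Bool → Subgroup F) (C : Subgroup F) : Bool → F → Prop
  | base (b : Bool) (r : F) : r ∈ H b → r ∉ C → Alt H C b r
  | step (b : Bool) (r w : F) : r ∈ H b → r ∉ C → Alt H C (!b) w → Alt H C b (r * w)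

lemma alt_C {H : Bool → Subgroup F} {C : Subgroup F} (hC : ∀ b, C ≤ H b) {b : Bool} {γ w : F}
    (hγ : γ ∈ C) (hw : Alt H C b w) : Alt H C b (γ * w) := by
  cases hw with
  | base _ _ h1 h2 =>
    exact .base b _ (mul_mem (hC _ hγ) h1) (fun h => h2 ((Subgroup.mul_mem_cancel_left _ hγ).1 h))
  | step _ r w h1 h2 h3 =>
    rw [← mul_assoc]
    exact .step b _ _ (mul_mem (hC _ hγ) h1)
      (fun h => h2 ((Subgroup.mul_mem_cancel_left _ hγ).1 h)) h3

lemma alt_mul {H : Bool → Subgroup F} {C : Subgroup F} (hC : ∀ b, C ≤ H b) {b : Bool} {r w : F}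
    (hr : r ∈ H b) (hw : w ∈ C ∨ ∃ b', Alt H C b' w) :
    r * w ∈ C ∨ ∃ b', Alt H C b' (r * w) := by
  rcases hw with hw | ⟨b', hw⟩
  · by_cases h : r * w ∈ C
    · exact .inl h
    · exact .inr ⟨b, .base b _ (mul_mem hr (hC _ hw)) h⟩
  · by_cases hrC : r ∈ C
    · exact .inr ⟨b', alt_C hC hrC hw⟩
    by_cases hb : b' = b
    · subst hb
      cases hw with
      | base _ _ h1 h2 =>
        by_cases h : r * w ∈ C
        · exact .inl h
        · exact .inr ⟨b', .base b' _ (mul_mem hr h1) h⟩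
      | step _ r' w' h1 h2 h3 =>
        rw [← mul_assoc]
        by_cases h : r * r' ∈ C
        · exact .inr ⟨_, alt_C hC h h3⟩
        · exact .inr ⟨b', .step b' _ _ (mul_mem hr h1) h h3⟩
    · have : b' = !b := by cases b <;> cases b' <;> simp_all
      subst this
      exact .inr ⟨b, .step b _ _ hr hrC hw⟩

/-- The key word `u² v³`. -/
def c : F := FreeGroup.of 1 ^ 2 * FreeGroup.of 2 ^ 3

lemma c_word : c.toWord = [(1,true),(1,true),(2,true),(2,true),(2,true)] := by decide

lemma c_inv_word : (c⁻¹).toWord = [(2,false),(2,false),(2,false),(1,false),(1,false)] := by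
  rw [FreeGroup.toWord_inv, c_word]; decide

lemma c_cyc : FreeGroup.IsCyclicallyReduced c.toWord := by
  rw [c_word]; simp [FreeGroup.IsCyclicallyReduced, FreeGroup.IsReduced]

lemma c_inv_cyc : FreeGroup.IsCyclicallyReduced (c⁻¹).toWord := by
  rw [c_inv_word]; simp [FreeGroup.IsCyclicallyReduced, FreeGroup.IsReduced]

lemma c_ne : c ≠ 1 := by
  intro h
  have := congrArg FreeGroup.toWord h
  rw [c_word] at this
  simp at this

lemma c_centralizer {g : F} (h : Commute g c) : g ∈ Subgroup.zpowers c := by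
  refine centralizer_cyclic c g (FreeGroup.lift (fun i => Multiplicative.ofAdd
    (if i = 1 then -1 else if i = 2 then 1 else 0))) ?_ h
  simp [c]
  decide

/-- The discriminating family. -/
def fn (n : ℕ) : F →* F :=
  FreeGroup.lift (fun i => if i = 0 then (FreeGroup.of 2)⁻¹ else c ^ n * FreeGroup.of i * (c ^ n)⁻¹)

lemma fn_zero_of (n : ℕ) : fn n (FreeGroup.of 0) = (FreeGroup.of 2)⁻¹ := by simp [fn]

lemma fn_of (n : ℕ) {i : ℕ} (hi : i ≠ 0) :
    fn n (FreeGroup.of i) = c ^ n * FreeGroup.of i * (c ^ n)⁻¹ := by simp [fn, hi]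

/-- The two vertex groups. -/
def H : Bool → Subgroup F
  | true => Subgroup.closure {FreeGroup.of 0, c}
  | false => Subgroup.closure {x | ∃ i, i ≠ 0 ∧ x = FreeGroup.of i}

lemma fn_Q (n : ℕ) {q : F} (hq : q ∈ H false) : fn n q = c ^ n * q * (c ^ n)⁻¹ := by
  have : Set.EqOn (fn n) (MulAut.conj (c ^ n)).toMonoidHom (H false) := by
    apply MonoidHom.eqOn_closure
    rintro x ⟨i, hi, rfl⟩
    rw [fn_of n hi]; rfl
  exact this hq

lemma c_mem_Q : c ∈ H false := by
  have h1 : FreeGroup.of 1 ∈ H false := Subgroup.subset_closure ⟨1, by simp, rfl⟩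
  have h2 : FreeGroup.of 2 ∈ H false := Subgroup.subset_closure ⟨2, by simp, rfl⟩
  exact mul_mem (pow_mem h1 _) (pow_mem h2 _)

lemma c_mem_R : c ∈ H true := Subgroup.subset_closure (by simp)

lemma fn_c (n : ℕ) : fn n c = c := by
  rw [fn_Q n c_mem_Q, ← pow_succ, pow_succ']; simp

lemma fn_R (n : ℕ) {r : F} (hr : r ∈ H true) : fn n r = fn 0 r := by
  have : Set.EqOn (fn n) (fn 0) (H true) := by
    apply MonoidHom.eqOn_closure
    rintro x (rfl | rfl)
    · rw [fn_zero_of, fn_zero_of]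
    · rw [fn_c, fn_c]
  exact this hr

lemma fn_R_inj {r : F} (hr : r ∈ H true) (h : fn 0 r = 1) : r = 1 := by
  let κ : FreeGroup Bool →* F := FreeGroup.lift (fun b => if b then FreeGroup.of 0 else
    c * FreeGroup.of 0 ^ 3)
  have k1 : κ (FreeGroup.of true) = FreeGroup.of 0 := by simp [κ]
  have k2 : κ (FreeGroup.of false) = c * FreeGroup.of 0 ^ 3 := by simp [κ]
  have hle : H true ≤ κ.range := by
    refine (Subgroup.closure_le _).2 ?_
    rintro x (rfl | rfl)
    · exact ⟨_, k1⟩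
    · refine ⟨FreeGroup.of false * (FreeGroup.of true ^ 3)⁻¹, ?_⟩
      rw [map_mul, map_inv, map_pow, k1, k2]; simp
  obtain ⟨s, rfl⟩ := hle hr
  have hinj := square_free ((fn 0).comp κ) (by simp [k1, fn_zero_of])
    (by
      rw [MonoidHom.comp_apply, k2, map_mul, map_pow, fn_c, fn_zero_of, c]
      group)
  have : s = 1 := hinj (by simpa using h)
  rw [this, map_one]

lemma C_le (b : Bool) : Subgroup.zpowers c ≤ H b := by
  rw [Subgroup.zpowers_le]
  cases b
  · exact c_mem_Q
  · exact c_mem_R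

lemma R_not_commute {r : F} (hr : r ∈ H true) (h : r ∉ Subgroup.zpowers c) :
    ¬ Commute (fn 0 r) c := by
  intro hc
  obtain ⟨k, hk⟩ := c_centralizer hc
  apply h
  refine ⟨k, ?_⟩
  have hk : c ^ k = fn 0 r := hk
  have h1 : r * (c ^ k)⁻¹ = 1 := by
    apply fn_R_inj (mul_mem hr (inv_mem (zpow_mem c_mem_R k)))
    rw [map_mul, map_inv, map_zpow, fn_c, hk, mul_inv_cancel]
  exact (mul_inv_eq_one.1 h1).symm

lemma structure_all (w : F) :
    w ∈ Subgroup.zpowers c ∨ ∃ b, Alt H (Subgroup.zpowers c) b w := by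
  have gen : ∀ i : ℕ, ∃ b, FreeGroup.of i ∈ H b := by
    intro i
    by_cases hi : i = 0
    · subst hi; exact ⟨true, Subgroup.subset_closure (by simp)⟩
    · exact ⟨false, Subgroup.subset_closure ⟨i, hi, rfl⟩⟩
  have key : ∀ x w : F, (w ∈ Subgroup.zpowers c ∨ ∃ b, Alt H (Subgroup.zpowers c) b w) →
      (x * w ∈ Subgroup.zpowers c ∨ ∃ b, Alt H (Subgroup.zpowers c) b (x * w)) := by
    intro x
    induction x using FreeGroup.induction_on with
    | C1 => intro w hw; simpa using hw
    | of i => intro w hw; obtain ⟨b, hb⟩ := gen i; exact alt_mul C_le hb hw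
    | inv_of i _ =>
      intro w hw; obtain ⟨b, hb⟩ := gen i; exact alt_mul C_le (inv_mem hb) hw
    | mul a b ha hb => intro w hw; rw [mul_assoc]; exact ha _ (hb _ hw)
  simpa using key w 1 (.inl (one_mem _))

open Filter

lemma cpow_mem (m n : ℕ) (h : m + 1 ≤ n) : (c ^ n)⁻¹ ∈ P c⁻¹ m := by
  obtain ⟨k, rfl⟩ := Nat.exists_eq_add_of_le h
  have := stepA c_inv_cyc 1 1 (m + k) (by
    rw [inv_inv]; simpa using stepC c_ne 1)
  rw [mul_one, inv_pow, show 1 + (m + k) = m + 1 + k by ring] at this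
  exact P_mono (by omega) this

lemma stepA_plus {m k n : ℕ} {x : F} (h : m + k ≤ n) (hx : x ∉ P c⁻¹ m) : c ^ n * x ∈ P c k := by
  obtain ⟨j, rfl⟩ := Nat.exists_eq_add_of_le h
  have := stepA c_cyc m x (k + j) hx
  rw [← add_assoc] at this
  exact P_mono (by omega) this

lemma stepA_minus {m k n : ℕ} {x : F} (h : m + k ≤ n) (hx : x ∉ P c m) :
    (c ^ n)⁻¹ * x ∈ P c⁻¹ k := by
  obtain ⟨j, rfl⟩ := Nat.exists_eq_add_of_le h
  have := stepA c_inv_cyc m x (k + j) (by rwa [inv_inv])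
  rw [← add_assoc, inv_pow] at this
  exact P_mono (by omega) this

/-- Step through a `Q`-syllable. -/
lemma Q_step {q : F} (hq : q ∈ H false) (hqC : q ∉ Subgroup.zpowers c) (y : ℕ → F)
    (hy : ∀ m, ∀ᶠ n in atTop, (c ^ n)⁻¹ * y n ∈ P c⁻¹ m) (m : ℕ) :
    ∀ᶠ n in atTop, fn n q * y n ∈ P c m := by
  have hne : ¬ Commute q c⁻¹ := fun h => hqC (c_centralizer (by simpa using h.inv_right))
  obtain ⟨m', hm'⟩ := stepB (inv_ne_one.2 c_ne) q hne
  filter_upwards [hy m', eventually_ge_atTop (m' + m)] with n h1 h2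
  rw [fn_Q n hq, mul_assoc, mul_assoc]
  exact stepA_plus h2 (hm' _ h1)

lemma R_step {r : F} (hr : r ∈ H true) (hrC : r ∉ Subgroup.zpowers c) (y : ℕ → F)
    (hy : ∀ m, ∀ᶠ n in atTop, y n ∈ P c m) (m : ℕ) :
    ∀ᶠ n in atTop, (c ^ n)⁻¹ * (fn n r * y n) ∈ P c⁻¹ m := by
  obtain ⟨m', hm'⟩ := stepB c_ne _ (R_not_commute hr hrC)
  filter_upwards [hy m', eventually_ge_atTop (m' + m)] with n h1 h2
  rw [fn_R n hr]
  exact stepA_minus h2 (hm' _ h1)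

lemma pingpong {b : Bool} {w : F} (hw : Alt H (Subgroup.zpowers c) b w) :
    (b = false → ∀ m, ∀ᶠ n in atTop, fn n w ∈ P c m) ∧
    (b = true → ∀ m, ∀ᶠ n in atTop, (c ^ n)⁻¹ * fn n w ∈ P c⁻¹ m) := by
  induction hw with
  | base b r h1 h2 =>
    constructor
    · rintro rfl m
      have := Q_step h1 h2 (fun _ => 1) (fun m => by
        filter_upwards [eventually_ge_atTop (m + 1)] with n hn
        simpa using cpow_mem m n hn) m
      simpa using this
    · rintro rfl m
      filter_upwards [eventually_ge_atTop ((fn 0 r).toWord.length + 1 + m)] with n hn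
      rw [fn_R n h1]
      exact stepA_minus hn (stepC c_ne _)
  | step b r w h1 h2 h3 ih =>
    constructor
    · rintro rfl m
      simp only [map_mul]
      exact Q_step h1 h2 _ (ih.2 rfl) m
    · rintro rfl m
      simp only [map_mul]
      exact R_step h1 h2 _ (ih.1 rfl) m

lemma discriminating (w : F) (hw : w ≠ 1) : ∀ᶠ n in atTop, fn n w ≠ 1 := by
  rcases structure_all w with ⟨k, rfl⟩ | ⟨b, h⟩
  · refine Eventually.of_forall fun n => ?_
    simpa [fn_c] using hw
  · cases b
    · filter_upwards [(pingpong h).1 rfl 1] with n hn h1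
      rw [h1] at hn
      exact stepC c_ne 1 (by simpa using hn)
    · cases h with
      | base _ _ h1 h2 =>
        refine Eventually.of_forall fun n hn => R_not_commute h1 h2 ?_
        rw [← fn_R n h1, hn]
        exact Commute.one_left _
      | step _ r w h1 h2 h3 =>
        filter_upwards [(pingpong h3).1 rfl (((fn 0 r)⁻¹).toWord.length + 1)] with n hn h4
        rw [map_mul, fn_R n h1, mul_eq_one_iff_inv_eq] at h4
        rw [← h4] at hn
        exact stepC c_ne _ hn

/-- Homomorphisms are `Lgp`-homomorphisms. -/
def toHom (h : F →* F) : F →[Lgp] F where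
  toFun := h
  map_fun' := by
    intro n f x
    cases f with
    | one => exact map_one h
    | inv => exact map_inv h _
    | mul => exact map_mul h _ _
  map_rel' := by
    intro n r x
    exact Empty.elim r

lemma qf_eventually (h : ℕ → F →* F) (hd : ∀ w : F, w ≠ 1 → ∀ᶠ n in atTop, h n w ≠ 1)
    {α : Type} {k : ℕ} (ψ : Lgp.BoundedFormula α k) (hψ : ψ.IsQF) (a : α → F) (y : Fin k → F) :
    ∀ᶠ n in atTop, (ψ.Realize a y ↔ ψ.Realize (h n ∘ a) (h n ∘ y)) := by
  induction hψ with
  | falsum => exact Eventually.of_forall fun n => Iff.rfl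
  | of_isAtomic hat =>
    cases hat with
    | equal t₁ t₂ =>
      have ht : ∀ (t : Lgp.Term (α ⊕ Fin k)) (n : ℕ),
          t.realize (Sum.elim (h n ∘ a) (h n ∘ y)) = h n (t.realize (Sum.elim a y)) := by
        intro t n
        have := FirstOrder.Language.HomClass.realize_term (toHom (h n)) (t := t) (v := Sum.elim a y)
        rw [← Sum.comp_elim]
        exact this
      simp only [FirstOrder.Language.BoundedFormula.realize_bdEqual, ht]
      by_cases he : t₁.realize (Sum.elim a y) = t₂.realize (Sum.elim a y)
      · exact Eventually.of_forall fun n => by simp [he]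
      · filter_upwards [hd (t₁.realize (Sum.elim a y) * (t₂.realize (Sum.elim a y))⁻¹)
          (fun h => he (mul_inv_eq_one.1 h))] with n hn
        refine iff_of_false he fun h' => hn ?_
        rw [map_mul, map_inv, h', mul_inv_cancel]
    | rel R ts => exact Empty.elim R
  | imp _ _ ih1 ih2 =>
    filter_upwards [ih1, ih2] with n h1 h2
    simp only [FirstOrder.Language.BoundedFormula.realize_imp, h1, h2]

lemma universal_transfer (h : ℕ → F →* F) (hd : ∀ w : F, w ≠ 1 → ∀ᶠ n in atTop, h n w ≠ 1)
    {α : Type} (a b : α → F) (hab : ∀ n, h n ∘ a = b) (φ : Lgp.Formula α) (hφ : IsUniversalF φ)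
    (hb : φ.Realize b) : φ.Realize a := by
  obtain ⟨k, ψ, hψ, rfl⟩ := hφ
  rw [FirstOrder.Language.BoundedFormula.realize_alls] at hb ⊢
  intro y
  obtain ⟨n, hn⟩ := (qf_eventually h hd ψ hψ a y).exists
  rw [hn, hab]
  exact hb _

/-- The non-primitive element `z² u² v³`. -/
def aa : F := FreeGroup.of 0 ^ 2 * c

/-- The substitution making `u² v` into a basis element. -/
def al : F →* F := FreeGroup.lift (fun i =>
  if i = 2 then (FreeGroup.of 1 ^ 2)⁻¹ * FreeGroup.of 2 else FreeGroup.of i)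

def alInv : F →* F := FreeGroup.lift (fun i =>
  if i = 2 then FreeGroup.of 1 ^ 2 * FreeGroup.of 2 else FreeGroup.of i)

lemma al_inj : Function.Injective al := by
  have : alInv.comp al = MonoidHom.id F := by
    ext i
    by_cases hi : i = 2
    · subst hi; simp [al, alInv]
    · simp [al, alInv, hi]
  exact Function.LeftInverse.injective (g := alInv) (fun x => DFunLike.congr_fun this x)

/-- The discriminating family, normalised. -/
def hn (n : ℕ) : F →* F :=
  (MulAut.conj (((FreeGroup.of 1 ^ 2)⁻¹ * FreeGroup.of 2) ^ 2 : F)).toMonoidHom.comp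
    (al.comp (fn n))

lemma hn_aa (n : ℕ) : hn n aa = FreeGroup.of 2 := by
  have h1 : fn n aa = (FreeGroup.of 2)⁻¹ ^ 2 * (FreeGroup.of 1 ^ 2 * FreeGroup.of 2 ^ 3) := by
    rw [aa, map_mul, map_pow, fn_zero_of, fn_c, c]
  have h2 : al (FreeGroup.of 2) = (FreeGroup.of 1 ^ 2)⁻¹ * FreeGroup.of 2 := by simp [al]
  have h3 : al (FreeGroup.of 1) = FreeGroup.of 1 := by simp [al]
  have h4 : al (fn n aa) = ((FreeGroup.of 1 ^ 2)⁻¹ * FreeGroup.of 2)⁻¹ ^ 2 *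
      (FreeGroup.of 1 ^ 2 * ((FreeGroup.of 1 ^ 2)⁻¹ * FreeGroup.of 2) ^ 3) := by
    rw [h1]; simp only [map_mul, map_pow, map_inv, h2, h3]
  rw [hn, MonoidHom.comp_apply, MonoidHom.comp_apply, h4]
  change (((FreeGroup.of 1 ^ 2)⁻¹ * FreeGroup.of 2) ^ 2 : F) * _ *
    (((FreeGroup.of 1 ^ 2)⁻¹ * FreeGroup.of 2) ^ 2)⁻¹ = _
  simp only [pow_succ, pow_zero, one_mul]
  group

lemma hn_disc (w : F) (hw : w ≠ 1) : ∀ᶠ n in atTop, hn n w ≠ 1 := by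
  filter_upwards [discriminating w hw] with n h h'
  apply h
  apply al_inj
  rw [map_one]
  simpa [hn] using h'

/-- The embedding sending `x₂` to `aa`. -/
def emb : F →* F := FreeGroup.lift (fun i => if i = 2 then aa else FreeGroup.of (i + 3))

def embInv : F →* F := FreeGroup.lift (fun i =>
  if i = 0 then 1 else if i = 1 then (FreeGroup.of 2)⁻¹ else if i = 2 then FreeGroup.of 2
  else FreeGroup.of (i - 3))

lemma emb_inj : Function.Injective emb := by
  have : embInv.comp emb = MonoidHom.id F := by
    ext i
    by_cases hi : i = 2
    · subst hi
      simp only [emb, MonoidHom.comp_apply, FreeGroup.lift_apply_of, if_true, aa, c, map_mul, map_pow]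
      simp [embInv]
      group
    · simp [emb, embInv, hi]
  exact Function.LeftInverse.injective (g := embInv) (fun x => DFunLike.congr_fun this x)

/-- The affine action. -/
def act : (ZMod 7)ˣ →* MulAut (Multiplicative (ZMod 7)) where
  toFun u := AddEquiv.toMultiplicative (DistribMulAction.toAddEquiv (ZMod 7) u)
  map_one' := by ext x; simp
  map_mul' := by intro a b; ext x; simp [mul_smul]

abbrev Aff := Multiplicative (ZMod 7) ⋊[act] (ZMod 7)ˣ

def two7 : (ZMod 7)ˣ := ⟨2, 4, by decide, by decide⟩

lemma aff_sq : ∀ g : Aff, g.right = -1 → g ^ 2 = 1 := by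
  rintro ⟨x, u⟩ (rfl : u = -1)
  revert x
  decide

lemma aff_cube : ∀ g : Aff, g.right = two7 → g ^ 3 = 1 := by
  rintro ⟨x, u⟩ (rfl : u = two7)
  revert x
  decide

lemma not_primitive (e : F ≃* F) (he : e aa = FreeGroup.of 2) : False := by
  let χ : F →* (ZMod 7)ˣ := FreeGroup.lift (fun i => if i = 0 then -1 else if i = 1 then -1 else
    if i = 2 then two7 else 1)
  have χ0 : χ (FreeGroup.of 0) = -1 := by simp [χ]
  have χ1 : χ (FreeGroup.of 1) = -1 := by simp [χ]
  have χ2 : χ (FreeGroup.of 2) = two7 := by simp [χ]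
  let g : F →* Aff := FreeGroup.lift (fun i =>
    ⟨Multiplicative.ofAdd (if i = 2 then 1 else 0), χ (e.symm (FreeGroup.of i))⟩)
  let ψ : F →* Aff := g.comp e.toMonoidHom
  have hr : ∀ x, (ψ x).right = χ x := by
    have : SemidirectProduct.rightHom.comp g = χ.comp e.symm.toMonoidHom := by
      ext i; simp [g]
    intro x
    have := DFunLike.congr_fun this (e x)
    simpa [ψ] using this
  have h1 : ψ aa = 1 := by
    rw [aa, c, map_mul, map_mul, map_pow, map_pow, map_pow,
      aff_sq _ ((hr _).trans χ0), aff_sq _ ((hr _).trans χ1), aff_cube _ ((hr _).trans χ2)]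
    simp
  have h2 : (ψ aa).left = Multiplicative.ofAdd 1 := by
    simp [ψ, he, g]
  rw [h1] at h2
  revert h2
  decide

end NFH

/-- The free group of countably infinite rank is not `∀`-homogeneous: there are finite tuples
`a` and `b` of the same length with the same `∀`-type such that no automorphism sends `a`
to `b`. -/
theorem freeGroup_countable_rank_not_forall_homogeneous :
    ∃ (k : ℕ) (a b : Fin k → FreeGroup ℕ),
      (∀ φ : Lgp.Formula (Fin k), IsUniversalF φ → (φ.Realize a ↔ φ.Realize b)) ∧
      ¬ ∃ e : FreeGroup ℕ ≃* FreeGroup ℕ, ∀ i, e (a i) = b i := by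
  refine ⟨1, fun _ => NFH.aa, fun _ => FreeGroup.of 2, fun φ hφ => ⟨fun h => ?_, fun h => ?_⟩, ?_⟩
  · refine NFH.universal_transfer (fun _ => NFH.emb) (fun w hw => ?_) _ _ (fun n => ?_) φ hφ h
    · exact Filter.Eventually.of_forall fun n h' => hw (NFH.emb_inj (by rw [h', map_one]))
    · funext i; simp [NFH.emb]
  · refine NFH.universal_transfer NFH.hn NFH.hn_disc _ _ (fun n => ?_) φ hφ h
    funext i; exact NFH.hn_aa n
  · rintro ⟨e, he⟩
    exact NFH.not_primitive e (he 0)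
end
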